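/- Let I be a nonzero symmetric monomial ideal of K[x_1,...,x_n] with set Λ(I) of partitions corresponding to minimal monomial generators. Then the height of I equals max over λ ∈ Λ(I) of min(λ) := min{i : λ_i > 0}. -/

import Mathlib

open MvPolynomial

/-- The monomial `x^a` in `K[x_1,...,x_n]`. -/
noncomputable def mon (K : Type) [Field K] (n : ℕ) (a : Fin n → ℕ) :
    MvPolynomial (Fin n) K :=
  monomial (Finsupp.equivFunOnFinite.symm a) 1

/-- A monomial ideal: an ideal generated by monomials. -/
def IsMonomialIdeal (K : Type) [Field K] (n : ℕ)
    (I : Ideal (MvPolynomial (Fin n) K)) : Prop :=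
  ∃ S : Set (Fin n → ℕ), I = Ideal.span (mon K n '' S)

/-- A symmetric (`𝔖_n`-fixed) ideal. -/
def IsSymmetricIdeal (K : Type) [Field K] (n : ℕ)
    (I : Ideal (MvPolynomial (Fin n) K)) : Prop :=
  ∀ σ : Equiv.Perm (Fin n), Ideal.map (rename (σ : Fin n → Fin n)) I = I

/-- The exponent vector obtained from `a` by the Borel move `x^a ↦ x^a · x_i / x_j`. -/
def borelMoveVec (n : ℕ) (a : Fin n → ℕ) (i j : Fin n) : Fin n → ℕ :=
  fun k => if k = i then a k + 1 else if k = j then a k - 1 else a k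

/-- A symmetric strongly shifted ideal (sssi). -/
def IsSSSI (K : Type) [Field K] (n : ℕ)
    (I : Ideal (MvPolynomial (Fin n) K)) : Prop :=
  IsMonomialIdeal K n I ∧ IsSymmetricIdeal K n I ∧
    ∀ lam : Fin n → ℕ, Monotone lam → mon K n lam ∈ I →
      ∀ i j : Fin n, i < j → lam i < lam j →
        mon K n (borelMoveVec n lam i j) ∈ I

/-- The dominance order on partitions: `μ ⊴ λ`. -/
def dominates (n : ℕ) (μ lam : Fin n → ℕ) : Prop :=
  ∀ k : Fin n, ∑ i ∈ Finset.Ici k, μ i ≤ ∑ i ∈ Finset.Ici k, lam i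

/-- `a` is the exponent vector of a minimal monomial generator of the
monomial ideal `I`. -/
def IsMinGen (K : Type) [Field K] (n : ℕ) (I : Ideal (MvPolynomial (Fin n) K))
    (a : Fin n → ℕ) : Prop :=
  mon K n a ∈ I ∧ ∀ b : Fin n → ℕ, (∀ i, b i ≤ a i) → b ≠ a → mon K n b ∉ I

/-- The height (codimension) of an ideal: the infimum of the heights of the
prime ideals containing it. -/
noncomputable def idealHeight {R : Type} [CommRing R] (I : Ideal R) : ℕ∞ :=
  ⨅ (P : PrimeSpectrum R) (_ : I ≤ P.asIdeal), Order.height P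

/-- An ideal generated by a set of variables over a domain is prime. -/
theorem isPrime_span_X_image {σ R : Type*} [CommRing R] [IsDomain R] (s : Set σ) :
    (Ideal.span (X '' s : Set (MvPolynomial σ R))).IsPrime := by
  classical
  let φ : MvPolynomial σ R →ₐ[R] MvPolynomial σ R := aeval fun i => if i ∈ s then 0 else X i
  have hker : Ideal.span (X '' s : Set (MvPolynomial σ R)) = RingHom.ker φ := by
    apply le_antisymm
    · rw [Ideal.span_le]
      rintro _ ⟨i, hi, rfl⟩
      simp [φ, RingHom.mem_ker, hi]
    · intro p hp
      have hcomp : (Ideal.Quotient.mkₐ R (Ideal.span (X '' s : Set (MvPolynomial σ R)))).comp φ =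
          Ideal.Quotient.mkₐ R _ := by
        ext i
        by_cases hi : i ∈ s
        · have hX : (X i : MvPolynomial σ R) ∈ Ideal.span (X '' s) :=
            Ideal.subset_span ⟨i, hi, rfl⟩
          simpa [φ, hi] using (Ideal.Quotient.eq_zero_iff_mem.mpr hX).symm
        · simp [φ, hi]
      have hp' := DFunLike.congr_fun hcomp p
      rw [AlgHom.comp_apply, (RingHom.mem_ker).mp hp, map_zero] at hp'
      exact Ideal.Quotient.eq_zero_iff_mem.mp hp'.symm
  rw [hker]
  exact RingHom.ker_isPrime _

/-- A prime containing a finite set of variables has height at least their number. -/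
theorem card_le_height_of_X_mem {σ R : Type*} [CommRing R] [IsDomain R] (s : Finset σ)
    (P : PrimeSpectrum (MvPolynomial σ R)) (hP : ∀ i ∈ s, X i ∈ P.asIdeal) :
    (s.card : ℕ∞) ≤ Order.height P := by
  classical
  induction s using Finset.induction_on generalizing P with
  | empty => simp
  | insert a s ha ih =>
    let Q : PrimeSpectrum (MvPolynomial σ R) :=
      ⟨Ideal.span (X '' (s : Set σ)), isPrime_span_X_image _⟩
    have hQ : (s.card : ℕ∞) ≤ Order.height Q :=
      ih Q fun i hi => Ideal.subset_span ⟨i, hi, rfl⟩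
    have hQP : Q < P := by
      rw [← PrimeSpectrum.asIdeal_lt_asIdeal]
      refine lt_of_le_of_ne ?_ fun h => ?_
      · change Ideal.span _ ≤ _
        rw [Ideal.span_le]
        rintro _ ⟨i, hi, rfl⟩
        exact hP i (Finset.mem_insert_of_mem hi)
      · have hmem : (X a : MvPolynomial σ R) ∈ Q.asIdeal := h ▸ hP a (Finset.mem_insert_self _ _)
        obtain ⟨i, hi, hne⟩ := mem_ideal_span_X_image.mp hmem (Finsupp.single a 1)
          (by simp [X, mem_support_iff])
        have : i = a := by
          by_contra hia
          exact hne (by simp [Ne.symm hia])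
        exact ha (this ▸ hi)
    rw [Finset.card_insert_of_notMem ha]
    push_cast
    exact (add_le_add_left hQ 1).trans (Order.height_add_one_le hQP)

/-- The prime generated by finitely many variables has height at most their number. -/
theorem height_span_X_image_le {σ R : Type*} [Finite σ] [CommRing R] [IsDomain R]
    [IsNoetherianRing R] (s : Finset σ) :
    Order.height (⟨Ideal.span (X '' (s : Set σ)), isPrime_span_X_image _⟩ :
      PrimeSpectrum (MvPolynomial σ R)) ≤ s.card := by
  classical
  have := isPrime_span_X_image (R := R) (s : Set σ)
  rw [← PrimeSpectrum.height_eq_orderHeight]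
  refine (Ideal.height_le_card_of_mem_minimalPrimes_span_finset
    (s := s.image (X : σ → MvPolynomial σ R)) ?_).trans ?_
  · rw [Finset.coe_image, Ideal.minimalPrimes_eq_subsingleton_self]
    rfl
  · exact_mod_cast Finset.card_image_le

section

variable {K : Type} [Field K] {n : ℕ}

theorem mon_eq_prod (a : Fin n → ℕ) : mon K n a = ∏ i, X i ^ a i := by
  rw [mon, monomial_eq, C_1, one_mul, Finsupp.prod_fintype _ _ (by simp)]
  rfl

theorem rename_mon (σ : Equiv.Perm (Fin n)) (a : Fin n → ℕ) :
    rename σ (mon K n (a ∘ σ)) = mon K n a := by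
  simp only [mon_eq_prod, map_prod, map_pow, rename_X, Function.comp_apply]
  exact Equiv.prod_comp σ fun i => (X i : MvPolynomial (Fin n) K) ^ a i

theorem IsSymmetricIdeal.mon_comp_mem_iff {I : Ideal (MvPolynomial (Fin n) K)}
    (hI : IsSymmetricIdeal K n I) (σ : Equiv.Perm (Fin n)) (a : Fin n → ℕ) :
    mon K n (a ∘ σ) ∈ I ↔ mon K n a ∈ I := by
  have key : ∀ (τ : Equiv.Perm (Fin n)) (b : Fin n → ℕ),
      mon K n (b ∘ τ) ∈ I → mon K n b ∈ I := fun τ b h => by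
    rw [← hI τ, ← rename_mon τ b]
    exact Ideal.mem_map_of_mem (rename τ) h
  refine ⟨key σ a, fun h => key σ.symm _ ?_⟩
  simpa [Function.comp_assoc] using h

/-- Up to a permutation, every monomial of a symmetric ideal is divisible by a minimal generator
with weakly increasing exponents. -/
theorem IsSymmetricIdeal.exists_monotone_isMinGen_le {I : Ideal (MvPolynomial (Fin n) K)}
    (hI : IsSymmetricIdeal K n I) {b : Fin n → ℕ} (hb : mon K n b ∈ I) :
    ∃ (lam : Fin n → ℕ) (σ : Equiv.Perm (Fin n)), Monotone lam ∧ IsMinGen K n I lam ∧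
      lam ≤ b ∘ σ := by
  obtain ⟨a, ⟨haI, hab⟩, hmin⟩ := WellFounded.has_min
    (wellFounded_lt (α := Fin n → ℕ)) {a | mon K n a ∈ I ∧ a ≤ b} ⟨b, hb, le_rfl⟩
  let σ := Tuple.sort a
  refine ⟨a ∘ σ, σ, Tuple.monotone_sort a, ⟨(hI.mon_comp_mem_iff σ a).mpr haI, ?_⟩,
    fun i => hab (σ i)⟩
  intro c hc hne hcI
  have hca : c ∘ σ.symm ≤ a := fun i => by simpa using hc (σ.symm i)
  refine hmin (c ∘ σ.symm) ⟨(hI.mon_comp_mem_iff _ _).mpr hcI, hca.trans hab⟩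
    (lt_of_le_of_ne hca fun h => hne ?_)
  rw [← h, Function.comp_assoc, Equiv.symm_comp_self, Function.comp_id]

/-- A prime containing all permutations of a monomial supported in the positions from `i` on has
height greater than `i`. -/
theorem add_one_le_height_of_mon_mem {I : Ideal (MvPolynomial (Fin n) K)}
    (hI : IsSymmetricIdeal K n I) {lam : Fin n → ℕ} (hlam : mon K n lam ∈ I) {i : Fin n}
    (hi : ∀ k < i, lam k = 0) (P : PrimeSpectrum (MvPolynomial (Fin n) K)) (hP : I ≤ P.asIdeal) :
    ((i : ℕ) : ℕ∞) + 1 ≤ Order.height P := by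
  classical
  let s : Finset (Fin n) := {j | X j ∈ P.asIdeal}
  have hs : (s.card : ℕ∞) ≤ Order.height P :=
    card_le_height_of_X_mem s P fun j hj => by simpa [s] using hj
  refine le_trans ?_ hs
  suffices h : (i : ℕ) < s.card by exact_mod_cast h
  by_contra! hcard
  obtain ⟨t, ht, htc⟩ := Finset.exists_subset_card_eq (s := Finset.Iio i) (n := s.card)
    (by simpa using hcard)
  let σ : Equiv.Perm (Fin n) := (Finset.equivOfCardEq htc.symm).extendSubtype
  have hmem := hP ((hI.mon_comp_mem_iff σ lam).mpr hlam)
  rw [mon_eq_prod, P.isPrime.prod_mem_iff] at hmem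
  obtain ⟨j, -, hj⟩ := hmem
  have hjs : j ∈ s := by simpa [s] using P.isPrime.mem_of_pow_mem _ hj
  have hjt : σ j ∈ t := Equiv.extendSubtype_mem _ j hjs
  rw [Function.comp_apply, hi _ (Finset.mem_Iio.mp (ht hjt)), pow_zero] at hj
  exact P.isPrime.ne_top ((Ideal.eq_top_iff_one _).mpr hj)

end

/-- For a nonzero proper symmetric monomial ideal `I`, the height of `I`
equals the maximum over the partition generators `λ ∈ Λ(I)` of
`min(λ) = min{i : λ_i > 0}` (indices counted starting from 1). -/
theorem height_of_symmetric_monomial (K : Type) [Field K] (n : ℕ)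
    (I : Ideal (MvPolynomial (Fin n) K))
    (hmono : IsMonomialIdeal K n I) (hsym : IsSymmetricIdeal K n I)
    (hbot : I ≠ ⊥) (htop : I ≠ ⊤) :
    idealHeight I =
      sSup {c : ℕ∞ | ∃ lam : Fin n → ℕ, Monotone lam ∧ IsMinGen K n I lam ∧
        ∃ i : Fin n, lam i ≠ 0 ∧ (∀ k : Fin n, k < i → lam k = 0) ∧
          c = ((i : ℕ) : ℕ∞) + 1} := by
  apply le_antisymm
  · set T := {c : ℕ∞ | ∃ lam : Fin n → ℕ, Monotone lam ∧ IsMinGen K n I lam ∧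
        ∃ i : Fin n, lam i ≠ 0 ∧ (∀ k : Fin n, k < i → lam k = 0) ∧
          c = ((i : ℕ) : ℕ∞) + 1} with hT
    have hTn : sSup T ≤ n := sSup_le <| by
      rintro _ ⟨_, _, _, i, _, _, rfl⟩
      exact_mod_cast i.isLt
    obtain ⟨c, hc⟩ := ENat.ne_top_iff_exists.mp (ne_top_of_le_ne_top (ENat.natCast_ne_top n) hTn)
    rw [← hc] at hTn ⊢
    have hcn : c ≤ n := by exact_mod_cast hTn
    let s : Finset (Fin n) := {k | (k : ℕ) < c}
    have hs : s.card = c := by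
      rw [Fin.card_filter_val_lt, min_eq_right hcn]
    let P : PrimeSpectrum (MvPolynomial (Fin n) K) :=
      ⟨Ideal.span (X '' (s : Set (Fin n))), isPrime_span_X_image _⟩
    refine (iInf₂_le P ?_).trans (hs ▸ height_span_X_image_le s)
    obtain ⟨S, rfl⟩ := hmono
    rw [Ideal.span_le]
    rintro _ ⟨b, hb, rfl⟩
    obtain ⟨lam, σ, hlam, hgen, hle⟩ :=
      hsym.exists_monotone_isMinGen_le (Ideal.subset_span ⟨b, hb, rfl⟩)
    have hne : ∃ i, lam i ≠ 0 := by
      by_contra! h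
      refine htop ((Ideal.eq_top_iff_one _).mpr ?_)
      simpa [mon_eq_prod, h] using hgen.1
    obtain ⟨i, hi, hmin⟩ := WellFounded.has_min (wellFounded_lt (α := Fin n)) {i | lam i ≠ 0} hne
    have hic : (i : ℕ) < c := by
      have : ((i : ℕ) : ℕ∞) + 1 ≤ c := hc ▸ le_sSup
        ⟨lam, hlam, hgen, i, hi, fun k hk => by_contra fun h => hmin k h hk, rfl⟩
      exact_mod_cast this
    obtain ⟨k, hk, hki⟩ : ∃ k ∈ s, i ≤ σ.symm k := by
      by_contra! h
      have hcard := Finset.card_le_card_of_injOn (s := s) (t := Finset.Iio i) σ.symm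
        (fun k hk => Finset.mem_coe.mpr (Finset.mem_Iio.mpr (h k hk))) σ.symm.injective.injOn
      rw [hs, Fin.card_Iio] at hcard
      omega
    have hbk : b k ≠ 0 := by
      have h₁ : lam i ≤ lam (σ.symm k) := hlam hki
      have h₂ : lam (σ.symm k) ≤ b k := by simpa using hle (σ.symm k)
      have h₃ : lam i ≠ 0 := hi
      omega
    rw [mon_eq_prod]
    exact Ideal.mem_of_dvd _
      ((dvd_pow_self _ hbk).trans (Finset.dvd_prod_of_mem _ (Finset.mem_univ k)))
      (Ideal.subset_span ⟨k, hk, rfl⟩)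
  · refine sSup_le ?_
    rintro _ ⟨lam, _, hgen, i, _, hi, rfl⟩
    exact le_iInf₂ fun P hP => add_one_le_height_of_mon_mem hsym hgen.1 hi P hP
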